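/- arXiv:2410.20117 — 3 statements merged into one kernel-verified Lean document; each statement's English description precedes it below -/
import Mathlib

section
/- Let U be a 3×3 complex unitary matrix possessing a symmetric pair of off-diagonal zeros, i.e. there exist indices i ≠ j with U(i,j) = 0 and U(j,i) = 0. Then U is a two-level unitary matrix: there exists an index k such that U(k,l) = 0 and U(l,k) = 0 for every l ≠ k (so U is block diagonal with a 1×1 block at position k and a 2×2 unitary block on the complementary indices). -/
open Matrix ComplexOrder

/-- The positive semidefinite square root of a positive semidefinite matrix
(the definition of the older Mathlib, since removed there). -/
noncomputable def Matrix.PosSemidef.sqrt {n 𝕜 : Type*} [Fintype n] [RCLike 𝕜] [DecidableEq n]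
    {A : Matrix n n 𝕜} (hA : A.PosSemidef) : Matrix n n 𝕜 :=
  hA.1.eigenvectorUnitary.1 * diagonal ((↑) ∘ Real.sqrt ∘ hA.1.eigenvalues) *
  (star hA.1.eigenvectorUnitary : Matrix n n 𝕜)

/-- The positive semidefinite square root of a matrix (junk value `0` if not PSD). -/
noncomputable def psdSqrt {n : Type*} [Fintype n] [DecidableEq n]
    (A : Matrix n n ℂ) : Matrix n n ℂ :=
  letI := Classical.propDecidable A.PosSemidef
  if h : A.PosSemidef then h.sqrt else 0

/-- Fidelity `F(ρ,σ) = tr √(√σ ρ √σ)`. -/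
noncomputable def fid {n : Type*} [Fintype n] [DecidableEq n]
    (ρ σ : Matrix n n ℂ) : ℝ :=
  (psdSqrt (psdSqrt σ * ρ * psdSqrt σ)).trace.re

/-- Trace norm `‖M‖₁ = tr √(M* M)`. -/
noncomputable def traceNorm {n : Type*} [Fintype n] [DecidableEq n]
    (M : Matrix n n ℂ) : ℝ :=
  (psdSqrt (Mᴴ * M)).trace.re

/-- Inner product on `ℂ^ι`, conjugate-linear in the first argument. -/
noncomputable def cinner {ι : Type*} [Fintype ι] (x y : ι → ℂ) : ℂ := star x ⬝ᵥ y

/-- Rank-one density operator `φφ*` of a vector `φ`. -/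
noncomputable def outer {ι : Type*} [Fintype ι] (φ : ι → ℂ) : Matrix ι ι ℂ :=
  vecMulVec φ (star φ)

theorem stmt3_aux (U : Matrix (Fin 3) (Fin 3) ℂ) (hU : Uᴴ * U = 1) (k : Fin 3)
    (hk : ∀ l, l ≠ k → U l k = 0) : ∀ l : Fin 3, l ≠ k → U k l = 0 ∧ U l k = 0 := by
  have key : ∀ l, star (U k k) * U k l = (1 : Matrix (Fin 3) (Fin 3) ℂ) k l := by
    intro l
    rw [← hU, Matrix.mul_apply, Finset.sum_eq_single k]
    · rfl
    · intro b _ hb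
      simp [Matrix.conjTranspose_apply, hk b hb]
    · simp
  intro l hl
  refine ⟨?_, hk l hl⟩
  have h1 := key k
  have h2 := key l
  rw [Matrix.one_apply_eq] at h1
  rw [Matrix.one_apply_ne hl.symm] at h2
  rcases mul_eq_zero.mp h2 with h | h
  · rw [h, zero_mul] at h1
    exact absurd h1 zero_ne_one
  · exact h

theorem stmt3 (U : Matrix (Fin 3) (Fin 3) ℂ) (hU : Uᴴ * U = 1)
    (hzeros : ∃ i j : Fin 3, i ≠ j ∧ U i j = 0 ∧ U j i = 0) :
    ∃ k : Fin 3, ∀ l : Fin 3, l ≠ k → U k l = 0 ∧ U l k = 0 := by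
  obtain ⟨i, j, hij, h1, h2⟩ := hzeros
  obtain ⟨m, hmi, hmj, hall⟩ : ∃ m : Fin 3, m ≠ i ∧ m ≠ j ∧ ∀ l, l = i ∨ l = j ∨ l = m := by
    clear h1 h2
    revert i j
    decide
  have h : star (U m i) * U m j = 0 := by
    have h0 : (Uᴴ * U) i j = 0 := by rw [hU, Matrix.one_apply_ne hij]
    rw [Matrix.mul_apply, Finset.sum_eq_single m] at h0
    · exact h0
    · intro b _ hb
      rcases hall b with rfl | rfl | rfl
      · simp [h1]
      · simp [Matrix.conjTranspose_apply, h2]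
      · exact absurd rfl hb
    · simp
  rcases mul_eq_zero.mp h with h | h
  · refine ⟨i, stmt3_aux U hU i fun l hl => ?_⟩
    rcases hall l with rfl | rfl | rfl
    · exact absurd rfl hl
    · exact h2
    · exact star_eq_zero.mp h
  · refine ⟨j, stmt3_aux U hU j fun l hl => ?_⟩
    rcases hall l with rfl | rfl | rfl
    · exact h1
    · exact absurd rfl hl
    · exact h
end

section
/- Let φ₁, φ₂ be orthonormal unit vectors in ℂ³ and let Φ(ρ) = Σ_{i=1}^N pᵢ Uᵢ ρ Uᵢ* be a mixed unitary channel on 3×3 matrices (pᵢ > 0, Σ pᵢ = 1, Uᵢ unitary). Then F(Φ(φ₁φ₁*), Φ(φ₂φ₂*)) = 0 if and only if for every unit vector e₀ orthogonal to both φ₁ and φ₂ and for all 1 ≤ i, j ≤ N, the matrix A = Uⱼ*Uᵢ is a two-level unitary with respect to the orthonormal basis {e₀, φ₁, φ₂}: ⟨φ₁, Aφ₂⟩ = 0 and ⟨φ₂, Aφ₁⟩ = 0, and moreover either (⟨e₀, Aφ₁⟩ = 0 and ⟨φ₁, Ae₀⟩ = 0) or (⟨e₀, Aφ₂⟩ =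 0 and ⟨φ₂, Ae₀⟩ = 0). -/
open Matrix ComplexOrder

theorem psdSqrt_psd {n : Type*} [Fintype n] [DecidableEq n] {A : Matrix n n ℂ}
    (hA : A.PosSemidef) : (psdSqrt A).PosSemidef := by
  unfold psdSqrt
  rw [dif_pos hA]
  unfold Matrix.PosSemidef.sqrt
  rw [star_eq_conjTranspose]
  apply Matrix.PosSemidef.mul_mul_conjTranspose_same
  apply Matrix.PosSemidef.diagonal
  intro i
  simp only [Function.comp, Pi.zero_apply]
  exact RCLike.ofReal_nonneg.2 (Real.sqrt_nonneg _)

theorem psdSqrt_sq {n : Type*} [Fintype n] [DecidableEq n] {A : Matrix n n ℂ}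
    (hA : A.PosSemidef) : psdSqrt A * psdSqrt A = A := by
  unfold psdSqrt
  rw [dif_pos hA]
  unfold Matrix.PosSemidef.sqrt
  have h1 : (star hA.1.eigenvectorUnitary : Matrix n n ℂ) * hA.1.eigenvectorUnitary.1 = 1 :=
    Unitary.coe_star_mul_self _
  have hs := hA.1.spectral_theorem
  rw [Unitary.conjStarAlgAut_apply] at hs
  set V : Matrix n n ℂ := hA.1.eigenvectorUnitary.1
  set W : Matrix n n ℂ := (star hA.1.eigenvectorUnitary : Matrix n n ℂ)
  set D : Matrix n n ℂ := diagonal (RCLike.ofReal ∘ Real.sqrt ∘ hA.1.eigenvalues)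
  have hD : D * D = diagonal (RCLike.ofReal ∘ hA.1.eigenvalues) := by
    simp only [D, diagonal_mul_diagonal]
    congr 1
    funext i
    have := Real.mul_self_sqrt (hA.eigenvalues_nonneg i)
    simp only [Function.comp]
    rw [← RCLike.ofReal_mul, this]
  calc V * D * W * (V * D * W) = V * D * (W * V) * D * W := by simp only [Matrix.mul_assoc]
    _ = V * (D * D) * W := by rw [h1, Matrix.mul_one, Matrix.mul_assoc V D D]
    _ = A := by rw [hD]; exact hs.symm

theorem fid_zero_iff {n : Type*} [Fintype n] [DecidableEq n] {ρ σ : Matrix n n ℂ}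
    (hρ : ρ.PosSemidef) (hσ : σ.PosSemidef) : fid ρ σ = 0 ↔ (ρ * σ).trace = 0 := by
  have hS := psdSqrt_psd hσ
  have hS2 := psdSqrt_sq hσ
  unfold fid
  set S := psdSqrt σ
  have hT : (S * ρ * S).PosSemidef := by
    have := hρ.mul_mul_conjTranspose_same S
    rwa [hS.1.eq] at this
  have hR := psdSqrt_psd hT
  have hR2 := psdSqrt_sq hT
  have htr : (S * ρ * S).trace = (ρ * σ).trace := by
    rw [Matrix.mul_assoc, Matrix.trace_mul_comm, Matrix.mul_assoc, hS2]
  rw [← htr, hT.trace_eq_zero_iff]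
  have hnn := hR.trace_nonneg
  constructor
  · intro h
    have : (psdSqrt (S * ρ * S)).trace = 0 := by
      apply Complex.ext
      · exact h
      · exact (Complex.nonneg_iff.1 hnn).2.symm
    rw [hR.trace_eq_zero_iff] at this
    rw [← hR2, this, Matrix.mul_zero]
  · intro h
    have h0 : psdSqrt (S * ρ * S) = 0 := by
      rw [← Matrix.conjTranspose_mul_self_eq_zero, hR.1.eq, hR2, h]
    rw [h0]
    simp

theorem conj_outer {n : Type*} [Fintype n] (U : Matrix n n ℂ) (φ : n → ℂ) :
    U * outer φ * Uᴴ = outer (U *ᵥ φ) := by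
  unfold outer
  rw [Matrix.mul_vecMulVec, Matrix.vecMulVec_mul, Matrix.star_mulVec]

theorem outer_psd {n : Type*} [Fintype n] (φ : n → ℂ) : (outer φ).PosSemidef :=
  Matrix.posSemidef_vecMulVec_self_star φ

theorem trace_outer {n : Type*} [Fintype n] (u v : n → ℂ) :
    (outer u * outer v).trace = ((Complex.normSq (cinner u v) : ℝ) : ℂ) := by
  unfold outer cinner
  rw [Matrix.vecMulVec_mul_vecMulVec, Matrix.trace_vecMulVec, dotProduct_smul, smul_eq_mul,
    ← Complex.mul_conj]
  congr 1
  simp [dotProduct, mul_comm]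

theorem cinner_adj {n : Type*} [Fintype n] (A B : Matrix n n ℂ) (u v : n → ℂ) :
    cinner u ((Aᴴ * B) *ᵥ v) = cinner (A *ᵥ u) (B *ᵥ v) := by
  unfold cinner
  rw [← Matrix.mulVec_mulVec, Matrix.dotProduct_mulVec, Matrix.star_mulVec]

theorem cinner_conj {n : Type*} [Fintype n] (u v : n → ℂ) :
    star (cinner u v) = cinner v u := by
  unfold cinner
  rw [Matrix.star_dotProduct, star_star]

theorem fid_mix {N : ℕ} {p : Fin N → ℝ} (hp : ∀ i, 0 < p i)
    (x y : Fin N → Fin 3 → ℂ) :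
    fid (∑ i, (p i : ℂ) • outer (x i)) (∑ i, (p i : ℂ) • outer (y i)) = 0 ↔
      ∀ i j, cinner (x i) (y j) = 0 := by
  have hpsd : ∀ z : Fin N → Fin 3 → ℂ, (∑ i, (p i : ℂ) • outer (z i)).PosSemidef := by
    intro z
    apply Matrix.posSemidef_sum
    intro i _
    exact (outer_psd _).smul (by exact_mod_cast (hp i).le)
  rw [fid_zero_iff (hpsd x) (hpsd y)]
  have : ((∑ i, (p i : ℂ) • outer (x i)) * (∑ i, (p i : ℂ) • outer (y i))).trace
      = ((∑ i, ∑ j, p i * p j * Complex.normSq (cinner (x i) (y j)) : ℝ) : ℂ) := by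
    simp only [Finset.sum_mul_sum, Matrix.trace_sum, Matrix.smul_mul, Matrix.mul_smul,
      Matrix.trace_smul, trace_outer, smul_eq_mul]
    push_cast
    exact Finset.sum_congr rfl fun i _ => Finset.sum_congr rfl fun j _ => by ring
  rw [this, Complex.ofReal_eq_zero]
  have hnn : ∀ i j, 0 ≤ p i * p j * Complex.normSq (cinner (x i) (y j)) := fun i j =>
    mul_nonneg (mul_pos (hp i) (hp j)).le (Complex.normSq_nonneg _)
  rw [Finset.sum_eq_zero_iff_of_nonneg fun i _ => Finset.sum_nonneg fun j _ => hnn i j]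
  refine ⟨fun h i j => ?_, fun h i _ => Finset.sum_eq_zero fun j _ => by simp [h i j]⟩
  have h1 := (Finset.sum_eq_zero_iff_of_nonneg fun j _ => hnn i j).1 (h i (Finset.mem_univ _)) j
    (Finset.mem_univ _)
  rcases mul_eq_zero.1 h1 with h2 | h2
  · exact absurd h2 (mul_pos (hp i) (hp j)).ne'
  · exact Complex.normSq_eq_zero.1 h2

theorem unitary_entry {M : Matrix (Fin 3) (Fin 3) ℂ} (h : Mᴴ * M = 1)
    (h12 : M 1 2 = 0) (h21 : M 2 1 = 0) :
    (M 0 1 = 0 ∧ M 1 0 = 0) ∨ (M 0 2 = 0 ∧ M 2 0 = 0) := by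
  have h' : M * Mᴴ = 1 := mul_eq_one_comm.1 h
  have c12 := congrFun (congrFun h 1) 2
  have c11 := congrFun (congrFun h 1) 1
  have c22 := congrFun (congrFun h 2) 2
  have r11 := congrFun (congrFun h' 1) 1
  have r22 := congrFun (congrFun h' 2) 2
  simp [Matrix.mul_apply, Fin.sum_univ_three, h12, h21] at c12 c11 c22 r11 r22
  rcases c12 with h0 | h0
  · left
    refine ⟨h0, ?_⟩
    rw [h0] at c11
    rw [mul_comm (M 1 1)] at r11
    have : M 1 0 * (starRingEnd ℂ) (M 1 0) = 0 := by linear_combination r11 - c11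
    simpa using this
  · right
    refine ⟨h0, ?_⟩
    rw [h0] at c22
    rw [mul_comm (M 2 2)] at r22
    have : M 2 0 * (starRingEnd ℂ) (M 2 0) = 0 := by linear_combination r22 - c22
    simpa using this

theorem exists_orth (u v : Fin 3 → ℂ) (hu : cinner u u = 1) (hv : cinner v v = 1)
    (h : cinner u v = 0) : ∃ e : Fin 3 → ℂ, cinner e e = 1 ∧ cinner e u = 0 ∧ cinner e v = 0 := by
  refine ⟨star (crossProduct u v), ?_, ?_, ?_⟩
  · have h2 : cinner v u = 0 := by rw [← cinner_conj, h, star_zero]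
    simp [cinner, dotProduct, Fin.sum_univ_three, cross_apply] at *
    linear_combination (starRingEnd ℂ (v 0) * v 0 + starRingEnd ℂ (v 1) * v 1 + starRingEnd ℂ (v 2) * v 2) * hu + hv
      - (starRingEnd ℂ (v 0) * u 0 + starRingEnd ℂ (v 1) * u 1 + starRingEnd ℂ (v 2) * u 2) * h
  · unfold cinner
    rw [star_star, dotProduct_comm, dot_self_cross]
  · unfold cinner
    rw [star_star, dotProduct_comm, dot_cross_self]

theorem stmt4 (φ₁ φ₂ : Fin 3 → ℂ)
    (hφ₁ : cinner φ₁ φ₁ = 1) (hφ₂ : cinner φ₂ φ₂ = 1) (horth : cinner φ₁ φ₂ = 0)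
    (N : ℕ) (hN : 1 ≤ N) (p : Fin N → ℝ) (hp : ∀ i, 0 < p i) (hpsum : ∑ i, p i = 1)
    (U : Fin N → Matrix (Fin 3) (Fin 3) ℂ) (hU : ∀ i, (U i)ᴴ * U i = 1) :
    fid (∑ i, (p i : ℂ) • (U i * outer φ₁ * (U i)ᴴ))
        (∑ i, (p i : ℂ) • (U i * outer φ₂ * (U i)ᴴ)) = 0 ↔
      ∀ e₀ : Fin 3 → ℂ, cinner e₀ e₀ = 1 → cinner e₀ φ₁ = 0 → cinner e₀ φ₂ = 0 →
        ∀ i j, (cinner φ₁ (((U j)ᴴ * U i) *ᵥ φ₂) = 0 ∧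
              cinner φ₂ (((U j)ᴴ * U i) *ᵥ φ₁) = 0) ∧
          ((cinner e₀ (((U j)ᴴ * U i) *ᵥ φ₁) = 0 ∧ cinner φ₁ (((U j)ᴴ * U i) *ᵥ e₀) = 0) ∨
            (cinner e₀ (((U j)ᴴ * U i) *ᵥ φ₂) = 0 ∧ cinner φ₂ (((U j)ᴴ * U i) *ᵥ e₀) = 0)) := by
  simp only [conj_outer]
  rw [fid_mix hp]
  constructor
  · intro h e he h1 h2 i j
    have ha : cinner φ₁ (((U j)ᴴ * U i) *ᵥ φ₂) = 0 := by
      rw [cinner_adj]; exact h j i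
    have hb : cinner φ₂ (((U j)ᴴ * U i) *ᵥ φ₁) = 0 := by
      rw [cinner_adj, ← cinner_conj, h i j, star_zero]
    refine ⟨⟨ha, hb⟩, ?_⟩
    have h1' : cinner φ₁ e = 0 := by rw [← cinner_conj, h1, star_zero]
    have h2' : cinner φ₂ e = 0 := by rw [← cinner_conj, h2, star_zero]
    have horth' : cinner φ₂ φ₁ = 0 := by rw [← cinner_conj, horth, star_zero]
    let b : Fin 3 → Fin 3 → ℂ := ![e, φ₁, φ₂]
    let B : Matrix (Fin 3) (Fin 3) ℂ := (Matrix.of b)ᵀ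
    have hent : ∀ (A : Matrix (Fin 3) (Fin 3) ℂ) k l, (Bᴴ * (A * B)) k l
        = cinner (b k) (A *ᵥ b l) := fun A k l => rfl
    have hB : Bᴴ * B = 1 := by
      ext k l
      have := hent 1 k l
      rw [Matrix.one_mul, Matrix.one_mulVec] at this
      rw [this]
      fin_cases k <;> fin_cases l <;> simp [b, *]
    have hB' : B * Bᴴ = 1 := mul_eq_one_comm.1 hB
    have hA : ((U j)ᴴ * U i)ᴴ * ((U j)ᴴ * U i) = 1 := by
      have hj : U j * (U j)ᴴ = 1 := mul_eq_one_comm.1 (hU j)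
      rw [conjTranspose_mul, conjTranspose_conjTranspose, Matrix.mul_assoc,
        ← Matrix.mul_assoc (U j), hj, Matrix.one_mul, hU i]
    generalize (U j)ᴴ * U i = A at *
    have hM : (Bᴴ * (A * B))ᴴ * (Bᴴ * (A * B)) = 1 := by
      rw [conjTranspose_mul, conjTranspose_mul, conjTranspose_conjTranspose]
      calc Bᴴ * Aᴴ * B * (Bᴴ * (A * B)) = Bᴴ * (Aᴴ * (B * Bᴴ) * A) * B := by
            simp only [Matrix.mul_assoc]
        _ = 1 := by rw [hB', Matrix.mul_one, hA, Matrix.mul_one, hB]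
    have := unitary_entry hM (by rw [hent]; exact ha) (by rw [hent]; exact hb)
    simp only [hent] at this
    exact this
  · intro h i j
    obtain ⟨e, he, h1, h2⟩ := exists_orth φ₁ φ₂ hφ₁ hφ₂ horth
    rw [← cinner_adj]
    exact (h e he h1 h2 j i).1.1
end

section
/- Let φ₁, φ₂ be unit vectors in ℂ^d with ⟨φ₁, φ₂⟩ ≠ 0 and let Φ(ρ) = Σ_{k=1}^N p_k U_k ρ U_k* be a mixed unitary channel on d×d matrices (p_k > 0, Σ p_k = 1, U_k unitary). Let M be the N×N complex matrix with entries M(j,k) = √(p_j p_k) · ⟨U_j φ₁, U_k φ₂⟩. Then Φ preserves the fidelity between φ₁ and φ₂, i.e. F(Φ(φ₁φ₁*), Φ(φ₂φ₂*)) = |⟨φ₁, φ₂⟩|, if and only if ‖M‖₁ = |⟨φ₁, φ₂⟩|. -/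
open Matrix ComplexOrder

lemma psdSqrt_of {n : Type*} [Fintype n] [DecidableEq n] {A : Matrix n n ℂ} (h : A.PosSemidef) :
    psdSqrt A = h.sqrt := by
  unfold psdSqrt
  simp [h]

lemma sqrt_trace {n : Type*} [Fintype n] [DecidableEq n] {A : Matrix n n ℂ} (h : A.PosSemidef) :
    (psdSqrt A).trace.re = (A.charpoly.roots.map (fun z => Real.sqrt z.re)).sum := by
  rw [psdSqrt_of h, h.1.roots_charpoly_eq_eigenvalues, Matrix.PosSemidef.sqrt,
    Matrix.trace_mul_cycle]
  have : (star h.1.eigenvectorUnitary : Matrix n n ℂ) * h.1.eigenvectorUnitary.1 = 1 :=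
    Unitary.coe_star_mul_self _
  rw [this, one_mul, Matrix.trace_diagonal]
  simp [Function.comp_def]

lemma sqrt_herm {n : Type*} [Fintype n] [DecidableEq n] {A : Matrix n n ℂ} (h : A.PosSemidef) :
    (psdSqrt A)ᴴ = psdSqrt A := by
  rw [psdSqrt_of h, Matrix.PosSemidef.sqrt]
  rw [Matrix.conjTranspose_mul, Matrix.conjTranspose_mul, Matrix.diagonal_conjTranspose,
    Matrix.star_eq_conjTranspose, Matrix.conjTranspose_conjTranspose, Matrix.mul_assoc]
  congr 3
  ext i
  simp

lemma sqrt_sq {n : Type*} [Fintype n] [DecidableEq n] {A : Matrix n n ℂ} (h : A.PosSemidef) :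
    psdSqrt A * psdSqrt A = A := by
  rw [psdSqrt_of h, Matrix.PosSemidef.sqrt]
  have h1 : (star h.1.eigenvectorUnitary : Matrix n n ℂ) * h.1.eigenvectorUnitary.1 = 1 :=
    Unitary.coe_star_mul_self _
  have h2 := h.1.spectral_theorem
  rw [Unitary.conjStarAlgAut_apply] at h2
  conv_rhs => rw [h2]
  set V := h.1.eigenvectorUnitary.1
  set W := (star h.1.eigenvectorUnitary : Matrix n n ℂ)
  set D : Matrix n n ℂ := diagonal ((RCLike.ofReal : ℝ → ℂ) ∘ Real.sqrt ∘ h.1.eigenvalues)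
  have : V * D * W * (V * D * W) = V * (D * D) * W := by
    calc _ = V * D * (W * V) * D * W := by simp only [Matrix.mul_assoc]
      _ = _ := by rw [h1]; simp only [Matrix.mul_assoc, Matrix.one_mul]
  rw [this]
  congr 2
  rw [Matrix.diagonal_mul_diagonal]
  congr 1
  ext i
  simp only [Function.comp_apply]
  have := Real.mul_self_sqrt (h.eigenvalues_nonneg i)
  exact_mod_cast congrArg (fun x : ℝ => (x : ℂ)) this

lemma sqrt_trace_comm {m n : Type*} [Fintype n] [DecidableEq n] [Fintype m] [DecidableEq m]
    (Y : Matrix m n ℂ) :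
    (psdSqrt (Yᴴ * Y)).trace.re = (psdSqrt (Y * Yᴴ)).trace.re := by
  rw [sqrt_trace (Matrix.posSemidef_conjTranspose_mul_self Y),
    sqrt_trace (Matrix.posSemidef_self_mul_conjTranspose Y)]
  have h := congrArg Polynomial.roots (Matrix.charpoly_mul_comm' Y Yᴴ)
  rw [Polynomial.roots_mul, Polynomial.roots_mul, Polynomial.roots_X_pow,
    Polynomial.roots_X_pow] at h
  · have h' := congrArg (fun s : Multiset ℂ => (s.map (fun z => Real.sqrt z.re)).sum) h
    simp [Multiset.map_nsmul, Multiset.sum_nsmul] at h'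
    exact h'.symm
  · exact mul_ne_zero (pow_ne_zero _ Polynomial.X_ne_zero) (Matrix.charpoly_monic _).ne_zero
  · exact mul_ne_zero (pow_ne_zero _ Polynomial.X_ne_zero) (Matrix.charpoly_monic _).ne_zero

lemma fid_eq {m n : Type*} [Fintype n] [DecidableEq n] [Fintype m] [DecidableEq m]
    (A B : Matrix m n ℂ) : fid (A * Aᴴ) (B * Bᴴ) = traceNorm (Aᴴ * B) := by
  have hB := Matrix.posSemidef_self_mul_conjTranspose B
  unfold fid traceNorm
  set S := psdSqrt (B * Bᴴ) with hS
  have hH : Sᴴ = S := sqrt_herm hB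
  have hs : S * S = B * Bᴴ := sqrt_sq hB
  have e1 : S * (A * Aᴴ) * S = (Aᴴ * S)ᴴ * (Aᴴ * S) := by
    rw [Matrix.conjTranspose_mul, hH, Matrix.conjTranspose_conjTranspose]
    simp only [Matrix.mul_assoc]
  have e2 : (Aᴴ * S) * (Aᴴ * S)ᴴ = (Aᴴ * B) * (Aᴴ * B)ᴴ := by
    rw [Matrix.conjTranspose_mul, Matrix.conjTranspose_mul, hH, Matrix.conjTranspose_conjTranspose]
    calc _ = Aᴴ * (S * S) * A := by simp only [Matrix.mul_assoc]
      _ = _ := by rw [hs]; simp only [Matrix.mul_assoc]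
  rw [e1, sqrt_trace_comm, e2, ← sqrt_trace_comm]

lemma chan_eq {d N : ℕ} (φ : Fin d → ℂ) (p : Fin N → ℝ) (hp : ∀ k, 0 < p k)
    (U : Fin N → Matrix (Fin d) (Fin d) ℂ) :
    (∑ k, (p k : ℂ) • (U k * outer φ * (U k)ᴴ)) =
      (Matrix.of fun i k => (Real.sqrt (p k) : ℂ) * (U k *ᵥ φ) i) *
      (Matrix.of fun i k => (Real.sqrt (p k) : ℂ) * (U k *ᵥ φ) i)ᴴ := by
  have h : ∀ k, U k * outer φ * (U k)ᴴ = vecMulVec (U k *ᵥ φ) (star (U k *ᵥ φ)) := by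
    intro k
    rw [outer, Matrix.mul_vecMulVec, Matrix.vecMulVec_mul, Matrix.star_mulVec]
  ext i j
  simp only [h, Matrix.sum_apply, Matrix.smul_apply, Matrix.mul_apply, Matrix.vecMulVec_apply,
    Matrix.conjTranspose_apply, Matrix.of_apply, smul_eq_mul, star_mul', Pi.star_apply]
  refine Finset.sum_congr rfl fun k _ => ?_
  have : (p k : ℂ) = (Real.sqrt (p k) : ℂ) * (Real.sqrt (p k) : ℂ) := by
    exact_mod_cast (Real.mul_self_sqrt (hp k).le).symm
  rw [this]
  simp only [Complex.star_def, Complex.conj_ofReal]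
  ring

theorem stmt9 (d : ℕ) (φ₁ φ₂ : Fin d → ℂ)
    (hφ₁ : cinner φ₁ φ₁ = 1) (hφ₂ : cinner φ₂ φ₂ = 1) (hne : cinner φ₁ φ₂ ≠ 0)
    (N : ℕ) (hN : 1 ≤ N) (p : Fin N → ℝ) (hp : ∀ k, 0 < p k) (hpsum : ∑ k, p k = 1)
    (U : Fin N → Matrix (Fin d) (Fin d) ℂ) (hU : ∀ k, (U k)ᴴ * U k = 1) :
    fid (∑ k, (p k : ℂ) • (U k * outer φ₁ * (U k)ᴴ))
        (∑ k, (p k : ℂ) • (U k * outer φ₂ * (U k)ᴴ)) = ‖cinner φ₁ φ₂‖ ↔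
      traceNorm (Matrix.of fun j k : Fin N =>
          (Real.sqrt (p j * p k) : ℂ) * cinner (U j *ᵥ φ₁) (U k *ᵥ φ₂)) =
        ‖cinner φ₁ φ₂‖ := by
  rw [chan_eq φ₁ p hp U, chan_eq φ₂ p hp U, fid_eq]
  have : (Matrix.of fun j k : Fin N =>
      (Real.sqrt (p j * p k) : ℂ) * cinner (U j *ᵥ φ₁) (U k *ᵥ φ₂)) =
      (Matrix.of fun i k => (Real.sqrt (p k) : ℂ) * (U k *ᵥ φ₁) i)ᴴ *
      (Matrix.of fun i k => (Real.sqrt (p k) : ℂ) * (U k *ᵥ φ₂) i) := by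
    ext j k
    simp only [Matrix.mul_apply, Matrix.conjTranspose_apply, Matrix.of_apply, cinner, dotProduct,
      Finset.mul_sum, star_mul', Pi.star_apply]
    refine Finset.sum_congr rfl fun i _ => ?_
    rw [Real.sqrt_mul (hp j).le]
    simp only [Complex.star_def, Complex.conj_ofReal, Complex.ofReal_mul]
    ring
  rw [this]
end
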